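/- Let (Ω, F, (F_t)_{t∈[0,T]}, P) be a filtered probability space satisfying the usual conditions, with T ∈ (0,∞). Let Y = (Y_t)_{t∈[0,T]} be an adapted real-valued process with right-continuous paths such that Y_T = 0 almost surely and E[∫_0^T |Y_s| ds] < ∞. Suppose there exist a progressively measurable process H = (H_t)_{t∈[0,T]} with E[∫_0^T |H_s| ds] < ∞ and a constant k ∈ (0, ∞) such that for every t ∈ [0,T]: (i) Y_t = E[∫_t^T H_s ds | F_t] almost surely, and (ii) H_t ≥ k·Y_t almost surely on the event {Y_t ≤ 0}. Then almost surely Y_t ≥ 0 for all t ∈ [0,T]. -/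

import Mathlib

open MeasureTheory
open Set Filter Topology Function

theorem integral_mul_intervalIntegral_swap {a f : ℝ → ℝ} (ha : Integrable a) (hf : Integrable f)
    {h : ℝ} (hh : 0 ≤ h) :
    ∫ t, a t * ∫ s in t..t + h, f s = ∫ s, f s * ∫ t in (s - h)..s, a t := by
  have hS : MeasurableSet {p : ℝ × ℝ | p.1 < p.2 ∧ p.2 ≤ p.1 + h} :=
    (measurableSet_lt measurable_fst measurable_snd).inter
      (measurableSet_le measurable_snd (measurable_fst.add_const h))
  have hint := (ha.mul_prod hf).indicator hS
  have hswap := integral_integral_swap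
    (f := fun t s => {p : ℝ × ℝ | p.1 < p.2 ∧ p.2 ≤ p.1 + h}.indicator
      (fun p => a p.1 * f p.2) (t, s)) hint
  have hl (t : ℝ) : ∫ s, {p : ℝ × ℝ | p.1 < p.2 ∧ p.2 ≤ p.1 + h}.indicator
      (fun p => a p.1 * f p.2) (t, s) = a t * ∫ s in t..t + h, f s := by
    rw [intervalIntegral.integral_of_le (by linarith), ← integral_indicator measurableSet_Ioc,
      ← integral_const_mul]
    congr 1 with s
    simp [indicator, mem_Ioc]
  have hr (s : ℝ) : ∫ t, {p : ℝ × ℝ | p.1 < p.2 ∧ p.2 ≤ p.1 + h}.indicator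
      (fun p => a p.1 * f p.2) (t, s) = f s * ∫ t in (s - h)..s, a t := by
    rw [intervalIntegral.integral_of_le (by linarith), ← integral_Ico_eq_integral_Ioc,
      ← integral_indicator measurableSet_Ico, ← integral_const_mul]
    congr 1 with t
    simp only [indicator, mem_Ico, mem_ofPred_eq, mul_ite, mul_zero, mul_comm (a t),
      sub_le_iff_le_add, and_comm]
  simpa only [hl, hr] using hswap

theorem abs_integral_mul_intervalIntegral_le {a f : ℝ → ℝ} {C : ℝ} (ha : Integrable a)
    (haC : ∀ t, |a t| ≤ C) (hf : Integrable f) {h : ℝ} (hh : 0 < h) :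
    |h⁻¹ * ∫ t, a t * ∫ s in t..t + h, f s| ≤ C * ∫ s, |f s| := by
  have hpt (s : ℝ) : ‖h⁻¹ * (f s * ∫ t in (s - h)..s, a t)‖ ≤ C * |f s| := by
    have := intervalIntegral.norm_integral_le_of_norm_le_const (a := s - h) (b := s)
      (f := a) (C := C) (fun t _ => haC t)
    rw [sub_sub_cancel, abs_of_pos hh] at this
    rw [norm_mul, norm_mul, norm_inv, Real.norm_of_nonneg hh.le, Real.norm_eq_abs (f s)]
    calc h⁻¹ * (|f s| * ‖∫ t in (s - h)..s, a t‖) ≤ h⁻¹ * (|f s| * (C * h)) := by gcongr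
      _ = C * |f s| := by field_simp
  rw [integral_mul_intervalIntegral_swap ha hf hh.le, ← integral_const_mul, ← integral_const_mul,
    ← Real.norm_eq_abs]
  exact norm_integral_le_of_norm_le (hf.abs.const_mul C) (ae_of_all _ hpt)

theorem tendsto_integral_mul_average {a f : ℝ → ℝ} {C : ℝ} (ha : Integrable a)
    (haC : ∀ t, |a t| ≤ C) (hf : Integrable f) {u : ℕ → ℝ} (hu : ∀ n, 0 < u n)
    (hu0 : Tendsto u atTop (𝓝 0)) :
    Tendsto (fun n => (u n)⁻¹ * ∫ t, a t * ∫ s in t..t + u n, f s) atTop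
      (𝓝 (∫ t, a t * f t)) := by
  simp only [fun n => integral_mul_intervalIntegral_swap ha hf (hu n).le, ← integral_const_mul]
  have hii (x y : ℝ) : IntervalIntegrable a volume x y := ha.intervalIntegrable
  refine tendsto_integral_of_dominated_convergence (fun s => C * |f s|) (fun n => ?_)
    (hf.abs.const_mul C) (fun n => ae_of_all _ fun s => ?_) ?_
  · have hc : Continuous fun s => ∫ t in (s - u n)..s, a t := by
      have hp := intervalIntegral.continuous_primitive hii 0
      have : (fun s => ∫ t in (s - u n)..s, a t) =
          fun s => (∫ t in (0 : ℝ)..s, a t) - ∫ t in (0 : ℝ)..(s - u n), a t := by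
        ext s
        rw [intervalIntegral.integral_interval_sub_left (hii _ _) (hii _ _)]
      rw [this]
      exact hp.sub (hp.comp (continuous_id.sub continuous_const))
    exact (hf.aestronglyMeasurable.mul hc.aestronglyMeasurable).const_mul _
  · have := intervalIntegral.norm_integral_le_of_norm_le_const (a := s - u n) (b := s)
      (f := a) (C := C) (fun t _ => haC t)
    rw [sub_sub_cancel, abs_of_pos (hu n)] at this
    have hn := hu n
    rw [norm_mul, norm_mul, norm_inv, Real.norm_of_nonneg hn.le, Real.norm_eq_abs (f s)]
    calc (u n)⁻¹ * (|f s| * ‖∫ t in (s - u n)..s, a t‖)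
        ≤ (u n)⁻¹ * (|f s| * (C * u n)) := by gcongr
      _ = C * |f s| := by field_simp
  · filter_upwards [LocallyIntegrable.ae_hasDerivAt_integral ha.locallyIntegrable] with s hs
    have h1 := (hasDerivAt_iff_tendsto_slope.1 (hs 0))
    have h2 : Tendsto (fun n => s - u n) atTop (𝓝[≠] s) := by
      refine tendsto_nhdsWithin_iff.2 ⟨by simpa using hu0.const_sub s, Eventually.of_forall
        fun n => ?_⟩
      have := hu n
      simp only [mem_compl_iff, mem_singleton_iff]
      linarith
    have h3 := (h1.comp h2).const_mul (f s)
    rw [mul_comm (f s) (a s)] at h3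
    refine h3.congr fun n => ?_
    have hn := hu n
    simp only [comp_apply, slope_def_field]
    rw [intervalIntegral.integral_interval_sub_left (hii _ _) (hii _ _),
      intervalIntegral.integral_symm]
    have : s - u n - s = - u n := by ring
    rw [this, neg_div_neg_eq]
    ring

section

variable {Ω : Type*} {m0 : MeasurableSpace Ω} {μ : Measure Ω}

theorem stronglyMeasurable_intervalIntegral_add {H : ℝ → Ω → ℝ} (hH : Measurable (uncurry H))
    {h : ℝ} (hh : 0 ≤ h) :
    StronglyMeasurable fun p : ℝ × Ω => ∫ s in p.1..p.1 + h, H s p.2 := by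
  have hS : MeasurableSet {p : (ℝ × Ω) × ℝ | p.1.1 < p.2 ∧ p.2 ≤ p.1.1 + h} :=
    (measurableSet_lt (measurable_fst.comp measurable_fst) measurable_snd).inter
      (measurableSet_le measurable_snd ((measurable_fst.comp measurable_fst).add_const h))
  have hm : Measurable fun p : (ℝ × Ω) × ℝ => H p.2 p.1.2 :=
    hH.comp (measurable_snd.prodMk (measurable_snd.comp measurable_fst))
  have := (hm.indicator hS).stronglyMeasurable.integral_prod_right' (ν := volume)
  convert this using 2 with p
  rw [intervalIntegral.integral_of_le (by linarith), ← integral_indicator measurableSet_Ioc]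
  congr 1

theorem tendsto_integral_integral_mul_average [SFinite μ] {A H : ℝ → Ω → ℝ} {C : ℝ}
    (hA : Measurable (uncurry A)) (hA_int : ∀ ω, Integrable fun t => A t ω)
    (hAC : ∀ t ω, |A t ω| ≤ C) (hH : Measurable (uncurry H))
    (hH_int : Integrable (uncurry H) (volume.prod μ)) {u : ℕ → ℝ} (hu : ∀ n, 0 < u n)
    (hu0 : Tendsto u atTop (𝓝 0)) :
    Tendsto (fun n => (u n)⁻¹ * ∫ ω, (∫ t, A t ω * ∫ s in t..t + u n, H s ω) ∂μ) atTop
      (𝓝 (∫ ω, (∫ t, A t ω * H t ω) ∂μ)) := by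
  simp only [← integral_const_mul (μ := μ)]
  have hsec : ∀ᵐ ω ∂μ, Integrable fun s => H s ω := hH_int.prod_left_ae
  refine tendsto_integral_of_dominated_convergence (fun ω => C * ∫ s, |H s ω|) (fun n => ?_)
    ?_ (fun n => ?_) ?_
  · have := (hA.stronglyMeasurable.mul
      (stronglyMeasurable_intervalIntegral_add hH (hu n).le)).integral_prod_left' (μ := volume)
    exact (this.const_mul _).aestronglyMeasurable
  · exact hH_int.abs.integral_prod_right.const_mul C
  · filter_upwards [hsec] with ω hω
    exact abs_integral_mul_intervalIntegral_le (hA_int ω) (fun t => hAC t ω) hω (hu n)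
  · filter_upwards [hsec] with ω hω
    exact tendsto_integral_mul_average (hA_int ω) (fun t => hAC t ω) hω hu hu0

theorem integrable_mul_intervalIntegral_add [SFinite μ] {A H : ℝ → Ω → ℝ} {b : ℝ → ℝ}
    (hA : Measurable (uncurry A)) (hH : Measurable (uncurry H))
    (hH_int : Integrable (uncurry H) (volume.prod μ)) (hb : Integrable b)
    (hAb : ∀ t ω, |A t ω| ≤ b t) {h : ℝ} (hh : 0 ≤ h) :
    Integrable (uncurry fun t ω => A t ω * ∫ s in t..t + h, H s ω) (volume.prod μ) := by
  refine (hb.mul_prod hH_int.abs.integral_prod_right).mono' (hA.stronglyMeasurable.mul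
    (stronglyMeasurable_intervalIntegral_add hH hh)).aestronglyMeasurable ?_
  have hsec : ∀ᵐ ω ∂μ, Integrable fun s => H s ω := hH_int.prod_left_ae
  have hsec' : ∀ᵐ p ∂((volume : Measure ℝ).prod μ), Integrable fun s => H s p.2 :=
    Measure.quasiMeasurePreserving_snd.ae hsec
  filter_upwards [hsec'] with p hp
  simp only [uncurry, norm_mul]
  refine mul_le_mul (hAb _ _) ?_ (norm_nonneg _) ((abs_nonneg _).trans (hAb p.1 p.2))
  rw [intervalIntegral.integral_of_le (by linarith)]
  exact (norm_integral_le_integral_norm _).trans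
    (setIntegral_le_integral hp.norm (ae_of_all _ fun _ => norm_nonneg _))

theorem ae_nonneg_of_integral_negPart_le [IsFiniteMeasure μ] {T k : ℝ} (hk : 0 < k)
    {Z H : ℝ → Ω → ℝ} (hZ : Measurable (uncurry Z)) (hH : Measurable (uncurry H))
    (hZ_int : Integrable (uncurry Z) (volume.prod μ))
    (hH_int : Integrable (uncurry H) (volume.prod μ))
    (hZ_supp : ∀ t ∉ Icc 0 T, ∀ ω, Z t ω = 0)
    (hZH : ∀ᵐ p ∂(volume.prod μ), Z p.1 p.2 ≤ 0 → k * Z p.1 p.2 ≤ H p.1 p.2)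
    (hle : ∀ t ∈ Icc 0 T, ∀ h, 0 ≤ h → ∫ ω, max (-Z t ω) 0 ∂μ ≤
      ∫ ω, max (-Z (t + h) ω) 0 ∂μ - ∫ ω in {ω | Z t ω ≤ 0}, (∫ s in t..t + h, H s ω) ∂μ) :
    ∀ᵐ p ∂(volume.prod μ), 0 ≤ Z p.1 p.2 := by
  classical
  set c : ℝ := k + 1 with hc
  set A : ℝ → Ω → ℝ := fun t ω => if t ∈ Icc 0 T ∧ Z t ω ≤ 0 then Real.exp (c * t) else 0 with hA
  set N : ℝ × Ω → ℝ := fun p => Real.exp (c * p.1) * max (-Z p.1 p.2) 0 with hN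
  have hZset (t : ℝ) : MeasurableSet {ω | Z t ω ≤ 0} :=
    measurableSet_le (hZ.comp measurable_prodMk_left) measurable_const
  have hA_meas : Measurable (uncurry A) :=
    Measurable.ite ((measurable_fst measurableSet_Icc).inter
      (measurableSet_le hZ measurable_const)) (by fun_prop) measurable_const
  have hA_le (t : ℝ) (ω : Ω) :
      |A t ω| ≤ (Icc 0 T).indicator (fun _ => Real.exp (c * T)) t := by
    simp only [hA, indicator]
    by_cases ht : t ∈ Icc 0 T
    · have : Real.exp (c * t) ≤ Real.exp (c * T) := by
        have := ht.2
        gcongr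
      by_cases h : Z t ω ≤ 0
      · simpa [ht, h] using this
      · simpa [ht, h] using (Real.exp_pos _).le
    · simp [ht]
  have hAC (t : ℝ) (ω : Ω) : |A t ω| ≤ Real.exp (c * T) :=
    (hA_le t ω).trans (indicator_le_self' (fun _ _ => (Real.exp_pos _).le) t)
  have hind : Integrable ((Icc 0 T).indicator fun _ : ℝ => Real.exp (c * T)) :=
    (integrable_indicator_iff measurableSet_Icc).2 (by simp)
  have hA_int (ω : Ω) : Integrable fun t => A t ω :=
    hind.mono' (hA_meas.comp measurable_prodMk_right).aestronglyMeasurable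
      (ae_of_all _ fun t => hA_le t ω)
  have hN_nonneg (p : ℝ × Ω) : 0 ≤ N p := by positivity
  have hN_int : Integrable N (volume.prod μ) := by
    refine (hZ_int.abs.const_mul (Real.exp (c * T))).mono' ?_ (ae_of_all _ fun p => ?_)
    · exact ((by fun_prop : Measurable fun p : ℝ × Ω => Real.exp (c * p.1)).mul
        (hZ.neg.max measurable_const)).aestronglyMeasurable
    · rw [Real.norm_of_nonneg (hN_nonneg p)]
      by_cases ht : p.1 ∈ Icc 0 T
      · have := ht.2
        have h2 : max (-Z p.1 p.2) 0 ≤ |Z p.1 p.2| := max_le (neg_le_abs _) (abs_nonneg _)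
        simp only [hN, uncurry]
        gcongr
      · simp only [hN, hZ_supp _ ht, neg_zero, max_self, mul_zero]
        positivity
  set W := ∫ p, N p ∂(volume.prod μ) with hW
  have hW' : W = ∫ t, Real.exp (c * t) * ∫ ω, max (-Z t ω) 0 ∂μ := by
    rw [hW, integral_prod _ hN_int]
    simp only [hN, integral_const_mul]
  have hg_int : Integrable fun t => Real.exp (c * t) * ∫ ω, max (-Z t ω) 0 ∂μ := by
    simpa only [hN, integral_const_mul] using hN_int.integral_prod_left
  have hbound (h : ℝ) (hh : 0 < h) : (1 - Real.exp (-(c * h))) * W ≤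
      -∫ ω, (∫ t, A t ω * ∫ s in t..t + h, H s ω) ∂μ := by
    have hint : Integrable (uncurry fun t ω => A t ω * ∫ s in t..t + h, H s ω)
        (volume.prod μ) :=
      integrable_mul_intervalIntegral_add hA_meas hH hH_int hind hA_le hh.le
    have hshift : ∀ t, Real.exp (c * t) * ∫ ω, max (-Z (t + h) ω) 0 ∂μ =
        Real.exp (-(c * h)) * (Real.exp (c * (t + h)) * ∫ ω, max (-Z (t + h) ω) 0 ∂μ) := by
      intro t
      rw [← mul_assoc, ← Real.exp_add]
      ring_nf
    have hpt (t : ℝ) : Real.exp (c * t) * ∫ ω, max (-Z t ω) 0 ∂μ ≤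
        Real.exp (-(c * h)) * (Real.exp (c * (t + h)) * ∫ ω, max (-Z (t + h) ω) 0 ∂μ) -
        ∫ ω, (A t ω * ∫ s in t..t + h, H s ω) ∂μ := by
      rw [← hshift]
      by_cases ht : t ∈ Icc 0 T
      · have h1 : ∫ ω, (A t ω * ∫ s in t..t + h, H s ω) ∂μ =
            Real.exp (c * t) * ∫ ω in {ω | Z t ω ≤ 0}, (∫ s in t..t + h, H s ω) ∂μ := by
          rw [← integral_indicator (hZset t), ← integral_const_mul]
          congr 1 with ω
          by_cases hω : Z t ω ≤ 0
          · simp only [hA, if_pos (And.intro ht hω), indicator, mem_ofPred_eq, if_pos hω]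
          · simp only [hA, hω, indicator, mem_ofPred_eq, and_false, if_false, mul_zero, zero_mul]
        rw [h1, ← mul_sub]
        exact mul_le_mul_of_nonneg_left (hle t ht h hh.le) (Real.exp_pos _).le
      · have h1 : ∀ ω, A t ω = 0 := fun ω => if_neg fun h => ht h.1
        simp only [h1, hZ_supp t ht, neg_zero, max_self, integral_zero, mul_zero, zero_mul,
          sub_zero]
        have : 0 ≤ ∫ ω, max (-Z (t + h) ω) 0 ∂μ := integral_nonneg fun _ => le_max_right _ _
        positivity
    have hg_shift := (hg_int.comp_add_right h).const_mul (Real.exp (-(c * h)))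
    have := integral_mono hg_int (hg_shift.sub hint.integral_prod_left) hpt
    simp only [Pi.sub_apply] at this
    rw [integral_sub hg_shift hint.integral_prod_left, integral_const_mul,
      integral_add_right_eq_self (fun t => Real.exp (c * t) * ∫ ω, max (-Z t ω) 0 ∂μ),
      ← hW'] at this
    have hsw := integral_integral_swap hint
    simp only [uncurry_apply_pair] at this
    rw [hsw] at this
    linarith
  have hlim : c * W ≤ -∫ ω, (∫ t, A t ω * H t ω) ∂μ := by
    have hu (n : ℕ) : (0 : ℝ) < 1 / ((n : ℝ) + 1) := Nat.one_div_pos_of_nat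
    have hu0 : Tendsto (fun n : ℕ => 1 / ((n : ℝ) + 1)) atTop (𝓝 0) :=
      tendsto_one_div_add_atTop_nhds_zero_nat
    have h1 := (tendsto_integral_integral_mul_average hA_meas hA_int hAC hH hH_int hu hu0).neg
    have hd : HasDerivAt (fun h => 1 - Real.exp (-(c * h))) c 0 := by
      have := (((hasDerivAt_id (0 : ℝ)).const_mul c).neg.exp).const_sub 1
      simpa using this
    have h2 := (hd.tendsto_slope_zero_right.comp (tendsto_nhdsWithin_iff.2
      ⟨hu0, Eventually.of_forall hu⟩)).mul_const W
    refine le_of_tendsto_of_tendsto' h2 h1 fun n => ?_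
    have hn := hu n
    have := mul_le_mul_of_nonneg_left (hbound _ hn) (inv_pos.2 hn).le
    simp only [comp_apply, smul_eq_mul, zero_add, mul_zero, neg_zero, Real.exp_zero, sub_self,
      sub_zero]
    linarith
  have hAH_int : Integrable (fun p : ℝ × Ω => A p.1 p.2 * H p.1 p.2) (volume.prod μ) :=
    hH_int.bdd_mul hA_meas.aestronglyMeasurable (ae_of_all _ fun p => hAC p.1 p.2)
  have hkW : -∫ ω, (∫ t, A t ω * H t ω) ∂μ ≤ k * W := by
    rw [← integral_prod_symm _ hAH_int, ← integral_neg, hW, ← integral_const_mul]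
    refine integral_mono_ae hAH_int.neg (hN_int.const_mul k) ?_
    filter_upwards [hZH] with p hp
    by_cases hA' : p.1 ∈ Icc 0 T ∧ Z p.1 p.2 ≤ 0
    · have := mul_le_mul_of_nonneg_left (hp hA'.2) (Real.exp_pos (c * p.1)).le
      simp only [hA, if_pos hA', hN, max_eq_left (neg_nonneg.2 hA'.2)]
      linarith
    · simp only [hA, if_neg hA', zero_mul, neg_zero]
      exact mul_nonneg hk.le (hN_nonneg p)
  have hW0 : W = 0 := le_antisymm (by linarith) (integral_nonneg hN_nonneg)
  filter_upwards [(integral_eq_zero_iff_of_nonneg hN_nonneg hN_int).1 hW0] with p hp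
  have := (mul_eq_zero.1 hp).resolve_left (Real.exp_pos _).ne'
  linarith [le_max_left (-Z p.1 p.2) 0]

theorem measurable_uncurry_of_continuousWithinAt_Ici {Y : ℝ → Ω → ℝ}
    (hY : ∀ t, Measurable (Y t))
    (hrc : ∀ ω t, ContinuousWithinAt (fun s => Y s ω) (Ici t) t) : Measurable (uncurry Y) := by
  refine measurable_of_tendsto_metrizable (f := fun (n : ℕ) (p : ℝ × Ω) =>
    Y ((⌊p.1 * (n + 1)⌋ + 1) / (n + 1)) p.2) (fun n => ?_) (tendsto_pi_nhds.2 fun p => ?_)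
  · have h1 : Measurable fun q : ℤ × Ω => Y ((q.1 + 1) / (n + 1)) q.2 :=
      measurable_from_prod_countable_right fun z => hY ((z + 1) / (n + 1))
    have h2 : Measurable fun p : ℝ × Ω => ((⌊p.1 * (n + 1)⌋, p.2) : ℤ × Ω) :=
      (Int.measurable_floor.comp (measurable_fst.mul_const _)).prodMk measurable_snd
    exact h1.comp h2
  · have hlow (n : ℕ) : p.1 ≤ (⌊p.1 * (n + 1)⌋ + 1) / (n + 1) := by
      rw [le_div_iff₀ (by positivity)]
      exact (Int.lt_floor_add_one _).le
    have hup (n : ℕ) : (⌊p.1 * (n + 1)⌋ + 1) / (n + 1) ≤ p.1 + 1 / ((n : ℝ) + 1) := by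
      rw [div_le_iff₀ (by positivity), add_mul, one_div_mul_cancel (by positivity)]
      gcongr
      exact Int.floor_le _
    refine (hrc p.2 p.1).tendsto.comp (tendsto_nhdsWithin_iff.2 ⟨?_, Eventually.of_forall hlow⟩)
    refine tendsto_of_tendsto_of_tendsto_of_le_of_le tendsto_const_nhds ?_ hlow hup
    simpa using (tendsto_one_div_add_atTop_nhds_zero_nat (𝕜 := ℝ)).const_add p.1

theorem integral_negPart_le_of_ae_eq_condExp [IsFiniteMeasure μ] {ℱ : Filtration ℝ m0}
    {Z H : ℝ → Ω → ℝ} {t u : ℝ} (htu : t ≤ u) (hZ : Measurable[ℱ t] (Z t))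
    (hH_int : Integrable (uncurry H) (volume.prod μ))
    (ht : Z t =ᵐ[μ] μ[fun ω => ∫ s in Ioi t, H s ω | ℱ t])
    (hu : Z u =ᵐ[μ] μ[fun ω => ∫ s in Ioi u, H s ω | ℱ u]) :
    ∫ ω, max (-Z t ω) 0 ∂μ ≤
      ∫ ω, max (-Z u ω) 0 ∂μ - ∫ ω in {ω | Z t ω ≤ 0}, (∫ s in t..u, H s ω) ∂μ := by
  have hS : MeasurableSet[ℱ t] {ω | Z t ω ≤ 0} := hZ measurableSet_Iic
  set S := {ω | Z t ω ≤ 0} with hSdef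
  have hX (I : Set ℝ) : Integrable (fun ω => ∫ s in I, H s ω) μ := by
    have : Integrable (uncurry H) ((volume.restrict I).prod μ) :=
      hH_int.mono_measure (Measure.prod_mono Measure.restrict_le_self le_rfl)
    exact this.integral_prod_right
  have hZt : Integrable (Z t) μ := integrable_condExp.congr ht.symm
  have hZu : Integrable (Z u) μ := integrable_condExp.congr hu.symm
  have h1 : ∫ ω, max (-Z t ω) 0 ∂μ = -∫ ω in S, Z t ω ∂μ := by
    rw [← integral_neg, ← integral_indicator (ℱ.le t _ hS)]
    congr 1 with ω
    by_cases h : Z t ω ≤ 0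
    · simp [hSdef, indicator, h]
    · simp [hSdef, indicator, h, (not_le.1 h).le]
  have h2 : ∫ ω in S, Z t ω ∂μ = ∫ ω in S, (∫ s in Ioi t, H s ω) ∂μ := by
    rw [setIntegral_congr_ae (ℱ.le t _ hS) (ht.mono fun _ h _ => h),
      setIntegral_condExp (ℱ.le t) (hX _) hS]
  have h3 : ∫ ω in S, Z u ω ∂μ = ∫ ω in S, (∫ s in Ioi u, H s ω) ∂μ := by
    rw [setIntegral_congr_ae (ℱ.le t _ hS) (hu.mono fun _ h _ => h),
      setIntegral_condExp (ℱ.le u) (hX _) (ℱ.mono htu _ hS)]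
  have h4 : ∫ ω in S, (∫ s in Ioi t, H s ω) ∂μ =
      ∫ ω in S, (∫ s in t..u, H s ω) ∂μ + ∫ ω in S, (∫ s in Ioi u, H s ω) ∂μ := by
    simp only [intervalIntegral.integral_of_le htu]
    rw [← integral_add (hX _).integrableOn (hX _).integrableOn]
    refine setIntegral_congr_ae (ℱ.le t _ hS) ?_
    have hsec : ∀ᵐ ω ∂μ, Integrable fun s => H s ω := hH_int.prod_left_ae
    filter_upwards [hsec] with ω hω _
    rw [← setIntegral_union (Ioc_disjoint_Ioi le_rfl) measurableSet_Ioi hω.integrableOn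
      hω.integrableOn, Ioc_union_Ioi_eq_Ioi htu]
  have hneg : Integrable (fun ω => max (-Z u ω) 0) μ := hZu.neg_part
  have h5 : -∫ ω in S, Z u ω ∂μ ≤ ∫ ω, max (-Z u ω) 0 ∂μ := by
    rw [← integral_neg]
    exact (integral_mono hZu.neg.integrableOn hneg.integrableOn fun _ => le_max_left _ _).trans
      (setIntegral_le_integral hneg (ae_of_all _ fun _ => le_max_right _ _))
  linarith

theorem integrable_uncurry_indicator [SFinite μ] {X : ℝ → Ω → ℝ} {I : Set ℝ}
    (hI : MeasurableSet I)
    (hX : Measurable (uncurry fun t ω => I.indicator (fun t => X t ω) t))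
    (hint : ∫⁻ ω, (∫⁻ s in I, ENNReal.ofReal |X s ω|) ∂μ < ⊤) :
    Integrable (uncurry fun t ω => I.indicator (fun t => X t ω) t) (volume.prod μ) := by
  refine ⟨hX.aestronglyMeasurable, ?_⟩
  rw [HasFiniteIntegral, lintegral_prod_symm _ hX.enorm.aemeasurable]
  convert hint using 3 with ω
  rw [← lintegral_indicator hI]
  congr 1 with s
  by_cases hs : s ∈ I <;> simp [hs, Real.enorm_eq_ofReal_abs]

theorem measurable_uncurry_indicator_Icc_of_isStronglyProgressive {ℱ : Filtration ℝ m0}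
    {H : ℝ → Ω → ℝ} (hH : IsStronglyProgressive ℱ H) (a b : ℝ) :
    Measurable (uncurry fun t ω => (Icc a b).indicator (fun t => H t ω) t) := by
  have hm : Measurable fun p : Iic b × Ω => H p.1 p.2 :=
    (hH b).measurable.mono (sup_le_sup le_rfl (MeasurableSpace.comap_mono (ℱ.le b))) le_rfl
  have hφ : Measurable fun p : ℝ × Ω => ((⟨min p.1 b, mem_Iic.2 (min_le_right _ _)⟩, p.2) : Iic b × Ω) :=
    ((measurable_fst.min measurable_const).subtype_mk).prodMk measurable_snd
  convert (hm.comp hφ).indicator (measurable_fst (measurableSet_Icc (a := a) (b := b))) using 1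
  ext ⟨t, ω⟩
  by_cases ht : t ∈ Icc a b
  · simp [indicator, ht.1, ht.2]
  · simp only [uncurry, indicator, ht, mem_preimage, if_false]

theorem nonneg_of_ae_nonneg_of_continuousWithinAt {y : ℝ → ℝ} {a b : ℝ}
    (hrc : ∀ t, ContinuousWithinAt y (Ici t) t)
    (hy : ∀ᵐ t, t ∈ Icc a b → 0 ≤ y t) {t : ℝ} (ht : t ∈ Ico a b) : 0 ≤ y t := by
  by_contra! hneg
  obtain ⟨u, hu, hsub⟩ := mem_nhdsGE_iff_exists_Ico_subset.1 ((hrc t).eventually_lt_const hneg)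
  obtain ⟨s, hs, hs'⟩ := (Measure.dense_of_ae hy).inter_open_nonempty _ isOpen_Ioo
    (nonempty_Ioo.2 (lt_min hu ht.2))
  have h1 : y s < 0 := hsub ⟨hs.1.le, hs.2.trans_le (min_le_left _ _)⟩
  exact h1.not_ge (hs' ⟨ht.1.trans hs.1.le, (hs.2.trans_le (min_le_right _ _)).le⟩)

end

/-- Generalized Skiadas lemma (stochastic Gronwall–Bellman inequality). -/
theorem generalized_skiadas_lemma
    {Ω : Type*} {m0 : MeasurableSpace Ω} {μ : Measure Ω} [IsProbabilityMeasure μ]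
    (T : ℝ) (hT : 0 < T)
    (ℱ : Filtration ℝ m0)
    (Y H : ℝ → Ω → ℝ)
    (hY_adapted : Adapted ℱ Y)
    (hY_rc : ∀ ω, ∀ t, ContinuousWithinAt (fun s => Y s ω) (Set.Ici t) t)
    (hYT : ∀ᵐ ω ∂μ, Y T ω = 0)
    (hY_int : ∫⁻ ω, (∫⁻ s in Set.Icc (0:ℝ) T, ENNReal.ofReal |Y s ω|) ∂μ < ⊤)
    (hH_prog : ProgMeasurable ℱ H)
    (hH_int : ∫⁻ ω, (∫⁻ s in Set.Icc (0:ℝ) T, ENNReal.ofReal |H s ω|) ∂μ < ⊤)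
    (k : ℝ) (hk : 0 < k)
    (hYH : ∀ t ∈ Set.Icc (0:ℝ) T,
      Y t =ᵐ[μ] μ[fun ω => ∫ s in Set.Icc t T, H s ω | ℱ t])
    (hHk : ∀ t ∈ Set.Icc (0:ℝ) T,
      ∀ᵐ ω ∂μ, Y t ω ≤ 0 → k * Y t ω ≤ H t ω) :
    ∀ᵐ ω ∂μ, ∀ t ∈ Set.Icc (0:ℝ) T, 0 ≤ Y t ω := by
  set Z : ℝ → Ω → ℝ := fun t ω => (Icc 0 T).indicator (fun t => Y t ω) t with hZ
  set K : ℝ → Ω → ℝ := fun t ω => (Icc 0 T).indicator (fun t => H t ω) t with hK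
  have hY_meas : Measurable (uncurry Y) := measurable_uncurry_of_continuousWithinAt_Ici
    (fun t => (hY_adapted t).mono (ℱ.le t) le_rfl) hY_rc
  have hZ_meas : Measurable (uncurry Z) := by
    convert hY_meas.indicator (measurable_fst (measurableSet_Icc (a := (0 : ℝ)) (b := T))) using 1
    ext ⟨t, ω⟩
    simp only [hZ, uncurry, indicator, mem_preimage]
  have hK_meas : Measurable (uncurry K) :=
    measurable_uncurry_indicator_Icc_of_isStronglyProgressive hH_prog 0 T
  have hZ_int : Integrable (uncurry Z) (volume.prod μ) :=
    integrable_uncurry_indicator measurableSet_Icc hZ_meas hY_int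
  have hK_int : Integrable (uncurry K) (volume.prod μ) :=
    integrable_uncurry_indicator measurableSet_Icc hK_meas hH_int
  have hZ_eq {t : ℝ} (ht : t ∈ Icc 0 T) : Z t = Y t := funext fun ω => indicator_of_mem ht _
  have hZ_supp (t : ℝ) (ht : t ∉ Icc 0 T) (ω : Ω) : Z t ω = 0 := indicator_of_notMem ht _
  have hZK : ∀ᵐ p ∂(volume.prod μ), Z p.1 p.2 ≤ 0 → k * Z p.1 p.2 ≤ K p.1 p.2 := by
    have hset : MeasurableSet {p : ℝ × Ω | Z p.1 p.2 ≤ 0 → k * Z p.1 p.2 ≤ K p.1 p.2} :=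
      (measurableSet_le hZ_meas measurable_const).imp
        (measurableSet_le (hZ_meas.const_mul k) hK_meas)
    refine (Measure.ae_prod_iff_ae_ae hset).2 (ae_of_all _ fun t => ?_)
    by_cases ht : t ∈ Icc 0 T
    · simpa only [hZ, hK, indicator_of_mem ht] using hHk t ht
    · simp [hZ, hK, indicator_of_notMem ht]
  have hcond {t : ℝ} (ht : 0 ≤ t) : Z t =ᵐ[μ] μ[fun ω => ∫ s in Ioi t, K s ω | ℱ t] := by
    simp only [hK, setIntegral_indicator measurableSet_Icc]
    by_cases htT : t ≤ T
    · have hI : Ioi t ∩ Icc 0 T = Ioc t T := by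
        ext s
        simp only [mem_inter_iff, mem_Ioi, mem_Icc, mem_Ioc]
        exact ⟨fun h => ⟨h.1, h.2.2⟩, fun h => ⟨h.1, (ht.trans_lt h.1).le, h.2⟩⟩
      simpa only [hI, hZ_eq (mem_Icc.2 ⟨ht, htT⟩), ← integral_Icc_eq_integral_Ioc]
        using hYH t ⟨ht, htT⟩
    · have hI : Ioi t ∩ Icc 0 T = ∅ := by
        ext s
        simp only [mem_inter_iff, mem_Ioi, mem_Icc, mem_empty_iff_false, iff_false]
        exact fun h => htT (h.1.le.trans h.2.2)
      have h0 : Z t = 0 := funext fun ω => hZ_supp t (fun h => htT h.2) ω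
      simp only [hI, Measure.restrict_empty, integral_zero_measure, h0]
      exact (condExp_zero (m := ℱ t) (μ := μ)).eventuallyEq.symm
  have hnonneg := ae_nonneg_of_integral_negPart_le hk hZ_meas hK_meas hZ_int hK_int hZ_supp hZK
    fun t ht h hh => integral_negPart_le_of_ae_eq_condExp (le_add_of_nonneg_right hh)
      (hZ_eq ht ▸ hY_adapted t) hK_int (hcond ht.1) (hcond (add_nonneg ht.1 hh))
  have hsec : ∀ᵐ ω ∂μ, ∀ᵐ t, 0 ≤ Z t ω :=
    Measure.ae_ae_of_ae_prod (Measure.measurePreserving_swap.quasiMeasurePreserving.ae hnonneg)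
  filter_upwards [hsec, hYT] with ω hω hTω t ht
  rcases ht.2.eq_or_lt with rfl | htT
  · exact hTω.ge
  · refine nonneg_of_ae_nonneg_of_continuousWithinAt (hY_rc ω) ?_ ⟨ht.1, htT⟩
    filter_upwards [hω] with s hs hsI
    rwa [hZ_eq hsI] at hs
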